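/- Each of the sets G_{Ω₀} = {A ∈ Matrix₇ₓ₇(ℝ) : A is invertible and Ω₀(A X, A Y, A Z) = Ω₀(X,Y,Z) for all X,Y,Z ∈ ℝ⁷} and G_{Ω₁} = {A ∈ Matrix₇ₓ₇(ℝ) : A is invertible and Ω₁(A X, A Y, A Z) = Ω₁(X,Y,Z) for all X,Y,Z ∈ ℝ⁷} is a connected subset of the space of 7×7 real matrices with its standard topology; that is, the stabilizer group of either generic 3-form on ℝ⁷ is a connected Lie group. -/

import Mathlib

open Matrix

noncomputable section

/-- The identification of `ℝ⁷ = (Fin 7 → ℝ)` with `ℝ × ℝ³ × ℝ³`,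
sending the standard basis to `(E₀, E₁, E₂, E₃, F₁, F₂, F₃)`. -/
def toV7 (v : Fin 7 → ℝ) : ℝ × (Fin 3 → ℝ) × (Fin 3 → ℝ) :=
  (v 0, ![v 1, v 2, v 3], ![v 4, v 5, v 6])

/-- The quadratic form `n(s,u,v) = -s² - 4 uᵀv`. -/
def nq (X : ℝ × (Fin 3 → ℝ) × (Fin 3 → ℝ)) : ℝ := -X.1 ^ 2 - 4 * (X.2.1 ⬝ᵥ X.2.2)

/-- The symmetric bilinear form associated to `n` by polarization. -/
def nb (X Y : ℝ × (Fin 3 → ℝ) × (Fin 3 → ℝ)) : ℝ := (nq (X + Y) - nq X - nq Y) / 2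

/-- The bilinear product `×` on `ℝ × ℝ³ × ℝ³`. -/
def cr (X Y : ℝ × (Fin 3 → ℝ) × (Fin 3 → ℝ)) : ℝ × (Fin 3 → ℝ) × (Fin 3 → ℝ) :=
  (2 * (X.2.1 ⬝ᵥ Y.2.2) - 2 * (X.2.2 ⬝ᵥ Y.2.1),
   X.1 • Y.2.1 - Y.1 • X.2.1 - (2 : ℝ) • (crossProduct X.2.2 Y.2.2),
   -(X.1 • Y.2.2) + Y.1 • X.2.2 + (2 : ℝ) • (crossProduct X.2.1 Y.2.1))

/-- The alternating 3-form `Ω₀(X,Y,Z) = n(X × Y, Z)` on `ℝ⁷`. -/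
def Omega0 (X Y Z : Fin 7 → ℝ) : ℝ := nb (cr (toV7 X) (toV7 Y)) (toV7 Z)

/-- The elementary alternating 3-form `eⁱ ∧ eʲ ∧ eᵏ` on `ℝ⁷`. -/
def eee (i j k : Fin 7) (X Y Z : Fin 7 → ℝ) : ℝ :=
  Matrix.det !![X i, X j, X k; Y i, Y j, Y k; Z i, Z j, Z k]

/-- The 3-form `Ω₁ = e¹⁴⁷ + e²⁵⁷ + e³⁶⁷ + e¹²³ − e¹⁵⁶ + e²⁴⁶ − e³⁴⁵` (1-based indices). -/
def Omega1 (X Y Z : Fin 7 → ℝ) : ℝ :=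
  eee 0 3 6 X Y Z + eee 1 4 6 X Y Z + eee 2 5 6 X Y Z + eee 0 1 2 X Y Z
    - eee 0 4 5 X Y Z + eee 1 3 5 X Y Z - eee 2 3 4 X Y Z

/-- The stabilizer group of a 3-form `Ω` on `ℝ⁷`, as a set of invertible `7×7`
real matrices. -/
def GSet (Ω : (Fin 7 → ℝ) → (Fin 7 → ℝ) → (Fin 7 → ℝ) → ℝ) :
    Set (Matrix (Fin 7) (Fin 7) ℝ) :=
  {A | IsUnit A ∧ ∀ X Y Z : Fin 7 → ℝ,
    Ω (A.mulVec X) (A.mulVec Y) (A.mulVec Z) = Ω X Y Z}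

open Set

/-- The space `ℝ⁷`. -/
abbrev V7 := Fin 7 → ℝ

/-- The space of real `7 × 7` matrices. -/
abbrev M7 := Matrix (Fin 7) (Fin 7) ℝ

/-- `D` is an infinitesimal symmetry of the trilinear form `Ω`. -/
def IsInfinitesimalSymmetry (Ω : V7 → V7 → V7 → ℝ) (D : M7) : Prop :=
  ∀ X Y Z, Ω (D *ᵥ X) Y Z + Ω X (D *ᵥ Y) Z + Ω X Y (D *ᵥ Z) = 0

theorem isConnected_of_connectedComponentIn_eq {α : Type*} [TopologicalSpace α] {G : Set α}
    {a : α} (ha : a ∈ G) (h : ∀ x ∈ G, connectedComponentIn G x = connectedComponentIn G a) :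
    IsConnected G := by
  have : G = connectedComponentIn G a :=
    Subset.antisymm (fun x hx => h x hx ▸ mem_connectedComponentIn hx)
      (connectedComponentIn_subset G a)
  exact ⟨⟨a, ha⟩, this ▸ isPreconnected_connectedComponentIn⟩

theorem GSet.one_mem (Ω : V7 → V7 → V7 → ℝ) : (1 : M7) ∈ GSet Ω := by
  simp [GSet]

theorem GSet.mul_mem {Ω : V7 → V7 → V7 → ℝ} {A B : M7} (hA : A ∈ GSet Ω) (hB : B ∈ GSet Ω) :
    A * B ∈ GSet Ω :=
  ⟨hA.1.mul hB.1, fun X Y Z => by simp only [← mulVec_mulVec, hA.2, hB.2]⟩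

/-- The symmetries of `Ω` whose left translations preserve the connected components of the
symmetry group. -/
def idComponent (Ω : V7 → V7 → V7 → ℝ) : Set M7 :=
  {U | U ∈ GSet Ω ∧ ∀ A ∈ GSet Ω,
    connectedComponentIn (GSet Ω) (U * A) = connectedComponentIn (GSet Ω) A}

theorem idComponent.mul_mem {Ω : V7 → V7 → V7 → ℝ} {U V : M7} (hU : U ∈ idComponent Ω)
    (hV : V ∈ idComponent Ω) : U * V ∈ idComponent Ω :=
  ⟨GSet.mul_mem hU.1 hV.1, fun A hA => by
    rw [Matrix.mul_assoc, hU.2 _ (GSet.mul_mem hV.1 hA), hV.2 _ hA]⟩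

theorem idComponent.exists_mul_eq_one {Ω : V7 → V7 → V7 → ℝ} {A U : M7}
    (hU : U ∈ idComponent Ω) (h : ∃ V ∈ idComponent Ω, V * (U * A) = 1) :
    ∃ V ∈ idComponent Ω, V * A = 1 := by
  obtain ⟨V, hV, h⟩ := h
  exact ⟨V * U, idComponent.mul_mem hV hU, by rw [Matrix.mul_assoc, h]⟩

/-- A connected family of symmetries through the identity lies in the identity component. -/
theorem idComponent.mem_of_family {Ω : V7 → V7 → V7 → ℝ} {ι : Type*} [TopologicalSpace ι]
    [PreconnectedSpace ι] {f : ι → M7} (hf : Continuous f) (hG : ∀ i, f i ∈ GSet Ω) {i₀ : ι}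
    (h₀ : f i₀ = 1) (i : ι) : f i ∈ idComponent Ω := by
  refine ⟨hG i, fun A hA => ?_⟩
  have hc : IsPreconnected (range fun i => f i * A) :=
    isPreconnected_range (hf.mul continuous_const)
  have hs : range (fun i => f i * A) ⊆ GSet Ω := by
    rintro _ ⟨j, rfl⟩
    exact GSet.mul_mem (hG j) hA
  exact (connectedComponentIn_eq
    (hc.subset_connectedComponentIn ⟨i₀, by simp [h₀]⟩ hs ⟨i, rfl⟩)).symm

theorem GSet.isConnected_of_reduction {Ω : V7 → V7 → V7 → ℝ}
    (h : ∀ A ∈ GSet Ω, ∃ U ∈ idComponent Ω, U * A = 1) : IsConnected (GSet Ω) := by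
  refine isConnected_of_connectedComponentIn_eq (GSet.one_mem Ω) fun A hA => ?_
  obtain ⟨U, hU, hUA⟩ := h A hA
  rw [← hU.2 A hA, hUA]

theorem IsInfinitesimalSymmetry.conj {Ω : V7 → V7 → V7 → ℝ} {D A : M7}
    (hD : IsInfinitesimalSymmetry Ω D) (hA : A ∈ GSet Ω) :
    IsInfinitesimalSymmetry Ω (A * D * A⁻¹) := by
  have hdet := (Matrix.isUnit_iff_isUnit_det A).1 hA.1
  have key : ∀ X, X = A *ᵥ (A⁻¹ *ᵥ X) := fun X => by
    rw [mulVec_mulVec, Matrix.mul_nonsing_inv _ hdet, one_mulVec]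
  intro X Y Z
  have := hD (A⁻¹ *ᵥ X) (A⁻¹ *ᵥ Y) (A⁻¹ *ᵥ Z)
  rw [← hA.2, ← hA.2 _ (D *ᵥ _), ← hA.2 _ _ (D *ᵥ _), ← key X, ← key Y, ← key Z] at this
  simpa only [← mulVec_mulVec] using this

/-- If the infinitesimal symmetries of `Ω = ⟨C(·,·), ·⟩` are skew for the form with Gram
matrix `S`, if `S` is the only symmetric form with this property up to scaling, and if `C` is a
cross product for `S`, then the symmetries of `Ω` preserve both `S` and `C`. -/
theorem GSet.preserves_form_and_cross {Ω : V7 → V7 → V7 → ℝ} {S : M7} {C : V7 → V7 → V7}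
    (hS : IsUnit S) (hSt : Sᵀ = S)
    (hΩ : ∀ X Y Z, Ω X Y Z = C X Y ⬝ᵥ S *ᵥ Z)
    (hC : ∀ X Y, C X Y ⬝ᵥ S *ᵥ C X Y =
      (X ⬝ᵥ S *ᵥ X) * (Y ⬝ᵥ S *ᵥ Y) - (X ⬝ᵥ S *ᵥ Y) ^ 2)
    (hskew : ∀ D, IsInfinitesimalSymmetry Ω D → Dᵀ * S + S * D = 0)
    (huniq : ∀ T : M7, Tᵀ = T → (∀ D, IsInfinitesimalSymmetry Ω D → Dᵀ * T + T * D = 0) →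
      ∃ c : ℝ, T = c • S)
    {X₀ Y₀ : V7} (h₀ : C X₀ Y₀ ⬝ᵥ S *ᵥ C X₀ Y₀ ≠ 0) {A : M7} (hA : A ∈ GSet Ω) :
    (∀ X Y, (A *ᵥ X) ⬝ᵥ S *ᵥ (A *ᵥ Y) = X ⬝ᵥ S *ᵥ Y) ∧
      ∀ X Y, C (A *ᵥ X) (A *ᵥ Y) = A *ᵥ C X Y := by
  have hdet := (Matrix.isUnit_iff_isUnit_det A).1 hA.1
  obtain ⟨c, hc⟩ := huniq (Aᵀ * S * A) (by simp [hSt, Matrix.mul_assoc]) (by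
    intro D hD
    have h := hskew _ (hD.conj hA)
    have h2 : Aᵀ * ((A * D * A⁻¹)ᵀ * S + S * (A * D * A⁻¹)) * A = 0 := by rw [h]; simp
    have hi : A⁻¹ * A = 1 := Matrix.nonsing_inv_mul _ hdet
    have hit : Aᵀ * A⁻¹ᵀ = 1 := by rw [← transpose_mul, hi, transpose_one]
    calc _ = (Aᵀ * A⁻¹ᵀ) * Dᵀ * Aᵀ * S * A + Aᵀ * S * A * D * (A⁻¹ * A) := by
            rw [hi, hit]; simp [Matrix.mul_assoc]
      _ = _ := by
            rw [← h2]
            simp only [transpose_mul, Matrix.mul_add, Matrix.add_mul, Matrix.mul_assoc])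
  have hN : ∀ X Y, (A *ᵥ X) ⬝ᵥ S *ᵥ (A *ᵥ Y) = c * (X ⬝ᵥ S *ᵥ Y) := by
    intro X Y
    have : (A *ᵥ X) ⬝ᵥ S *ᵥ (A *ᵥ Y) = X ⬝ᵥ (Aᵀ * S * A) *ᵥ Y := by
      rw [← mulVec_mulVec, ← mulVec_mulVec, dotProduct_mulVec X Aᵀ, vecMul_transpose]
    rw [this, hc, smul_mulVec, dotProduct_smul, smul_eq_mul]
  have hcross : ∀ X Y, c • C (A *ᵥ X) (A *ᵥ Y) = A *ᵥ C X Y := by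
    intro X Y
    have hSA : IsUnit (S * A) := hS.mul hA.1
    refine sub_eq_zero.1 (dotProduct_eq_zero _ fun W => ?_)
    obtain ⟨Z, rfl⟩ := (Matrix.mulVec_surjective_iff_isUnit.2 hSA) W
    rw [← mulVec_mulVec, sub_dotProduct, smul_dotProduct, ← hΩ, hA.2, hΩ, hN, smul_eq_mul,
      sub_self]
  have hc1 : c = 1 := by
    have h1 : c ^ 2 * (C (A *ᵥ X₀) (A *ᵥ Y₀) ⬝ᵥ S *ᵥ C (A *ᵥ X₀) (A *ᵥ Y₀)) =
        c * (C X₀ Y₀ ⬝ᵥ S *ᵥ C X₀ Y₀) := by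
      rw [← hN, ← hcross, mulVec_smul, dotProduct_smul, smul_dotProduct]
      simp only [smul_eq_mul]
      ring
    rw [hC (A *ᵥ X₀), hN, hN, hN] at h1
    have h2 : (c ^ 4 - c) * (C X₀ Y₀ ⬝ᵥ S *ᵥ C X₀ Y₀) = 0 := by
      linear_combination h1 + c ^ 4 * hC X₀ Y₀
    have hc0 : c ≠ 0 := by
      rintro rfl
      have hu : IsUnit (Aᵀ * S * A) := ((isUnit_transpose A).2 hA.1 |>.mul hS).mul hA.1
      rw [hc, zero_smul] at hu
      exact not_isUnit_zero hu
    have h3 : c * ((c - 1) * (c ^ 2 + c + 1)) = 0 := by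
      linear_combination (mul_eq_zero.1 h2).resolve_right h₀
    have h4 := (mul_eq_zero.1 ((mul_eq_zero.1 h3).resolve_left hc0)).resolve_right
      (by nlinarith [sq_nonneg (c + 1)])
    linarith
  subst hc1
  exact ⟨fun X Y => by rw [hN, one_mul], fun X Y => by rw [← hcross, one_smul]⟩

/-- The Gram matrix of the bilinear form `nb`. -/
def gram0 : M7 :=
  !![-1, 0, 0, 0, 0, 0, 0; 0, 0, 0, 0, -2, 0, 0; 0, 0, 0, 0, 0, -2, 0; 0, 0, 0, 0, 0, 0, -2;
     0, -2, 0, 0, 0, 0, 0; 0, 0, -2, 0, 0, 0, 0; 0, 0, 0, -2, 0, 0, 0]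

/-- The cross product `cr` in coordinates of `ℝ⁷`. -/
def cross0 (X Y : V7) : V7 :=
  ![2 * (X 1 * Y 4 + X 2 * Y 5 + X 3 * Y 6) - 2 * (X 4 * Y 1 + X 5 * Y 2 + X 6 * Y 3),
    X 0 * Y 1 - Y 0 * X 1 - 2 * (X 5 * Y 6 - X 6 * Y 5),
    X 0 * Y 2 - Y 0 * X 2 - 2 * (X 6 * Y 4 - X 4 * Y 6),
    X 0 * Y 3 - Y 0 * X 3 - 2 * (X 4 * Y 5 - X 5 * Y 4),
    -(X 0 * Y 4) + Y 0 * X 4 + 2 * (X 2 * Y 3 - X 3 * Y 2),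
    -(X 0 * Y 5) + Y 0 * X 5 + 2 * (X 3 * Y 1 - X 1 * Y 3),
    -(X 0 * Y 6) + Y 0 * X 6 + 2 * (X 1 * Y 2 - X 2 * Y 1)]

theorem mulVec_eq_vec7 (A : M7) (X : V7) :
    A *ᵥ X = ![∑ j, A 0 j * X j, ∑ j, A 1 j * X j, ∑ j, A 2 j * X j, ∑ j, A 3 j * X j,
      ∑ j, A 4 j * X j, ∑ j, A 5 j * X j, ∑ j, A 6 j * X j] := by
  ext i
  fin_cases i <;> rfl

theorem vec7_ext {X Y : V7} (h0 : X 0 = Y 0) (h1 : X 1 = Y 1) (h2 : X 2 = Y 2) (h3 : X 3 = Y 3)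
    (h4 : X 4 = Y 4) (h5 : X 5 = Y 5) (h6 : X 6 = Y 6) : X = Y := by
  ext i
  fin_cases i <;> assumption

theorem gram0_apply (X Y : V7) : X ⬝ᵥ gram0 *ᵥ Y =
    -(X 0 * Y 0) - 2 * (X 1 * Y 4 + X 2 * Y 5 + X 3 * Y 6 + X 4 * Y 1 + X 5 * Y 2 + X 6 * Y 3) := by
  simp [gram0, dotProduct, Fin.sum_univ_seven]
  ring

theorem isUnit_gram0 : IsUnit gram0 := by
  refine Matrix.mulVec_injective_iff_isUnit.1 fun X Y h => ?_
  simp [gram0] at h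
  obtain ⟨h0, h1, h2, h3, h4, h5, h6⟩ := h
  exact vec7_ext h0 h4 h5 h6 h1 h2 h3

theorem Omega0_eq (X Y Z : V7) : Omega0 X Y Z = cross0 X Y ⬝ᵥ gram0 *ᵥ Z := by
  rw [gram0_apply]
  simp [Omega0, nb, nq, cr, toV7, cross0, crossProduct, dotProduct, Fin.sum_univ_three]
  ring

theorem cross0_gram0 (X Y : V7) : cross0 X Y ⬝ᵥ gram0 *ᵥ cross0 X Y =
    (X ⬝ᵥ gram0 *ᵥ X) * (Y ⬝ᵥ gram0 *ᵥ Y) - (X ⬝ᵥ gram0 *ᵥ Y) ^ 2 := by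
  simp only [gram0_apply]
  simp [cross0]
  ring

/-- A linear map preserving a cross product and the form it comes with preserves the associated
trilinear form. -/
theorem GSet.mem_of_preserves {Ω : V7 → V7 → V7 → ℝ} {S : M7} {C : V7 → V7 → V7}
    (hS : IsUnit S) (hΩ : ∀ X Y Z, Ω X Y Z = C X Y ⬝ᵥ S *ᵥ Z) {A : M7}
    (hN : ∀ X Y, (A *ᵥ X) ⬝ᵥ S *ᵥ (A *ᵥ Y) = X ⬝ᵥ S *ᵥ Y)
    (hC : ∀ X Y, C (A *ᵥ X) (A *ᵥ Y) = A *ᵥ C X Y) : A ∈ GSet Ω := by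
  refine ⟨Matrix.mulVec_injective_iff_isUnit.1 fun X Y h => ?_, fun X Y Z => ?_⟩
  · refine sub_eq_zero.1 (dotProduct_eq_zero _ fun W => ?_)
    obtain ⟨Z, rfl⟩ := (Matrix.mulVec_surjective_iff_isUnit.2 hS) W
    rw [← hN, mulVec_sub, sub_eq_zero.2 h, zero_dotProduct]
  · rw [hΩ, hC, hN, hΩ]

/-- The unipotent symmetry of `Ω₀` generated by `(0, 0, w)`. -/
def lower0 (w : Fin 3 → ℝ) : M7 :=
  !![1, -2 * w 0, -2 * w 1, -2 * w 2, 0, 0, 0;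
     0, 1, 0, 0, 0, -w 2, w 1;
     0, 0, 1, 0, w 2, 0, -w 0;
     0, 0, 0, 1, -w 1, w 0, 0;
     w 0, -(w 0 * w 0), -(w 1 * w 0), -(w 2 * w 0), 1, 0, 0;
     w 1, -(w 0 * w 1), -(w 1 * w 1), -(w 2 * w 1), 0, 1, 0;
     w 2, -(w 0 * w 2), -(w 1 * w 2), -(w 2 * w 2), 0, 0, 1]

/-- The unipotent symmetry of `Ω₀` generated by `(0, w, 0)`. -/
def upper0 (w : Fin 3 → ℝ) : M7 :=
  !![1, 0, 0, 0, -2 * w 0, -2 * w 1, -2 * w 2;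
     w 0, 1, 0, 0, -(w 0 * w 0), -(w 1 * w 0), -(w 2 * w 0);
     w 1, 0, 1, 0, -(w 0 * w 1), -(w 1 * w 1), -(w 2 * w 1);
     w 2, 0, 0, 1, -(w 0 * w 2), -(w 1 * w 2), -(w 2 * w 2);
     0, 0, -w 2, w 1, 1, 0, 0;
     0, w 2, 0, -w 0, 0, 1, 0;
     0, -w 1, w 0, 0, 0, 0, 1]

/-- The transvection `u ↦ u + (p ⬝ᵥ u) • a` of `ℝ³`, acting on `ℝ × ℝ³ × (ℝ³)ᵛ`. -/
def transvection0 (a p : Fin 3 → ℝ) : M7 :=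
  !![1, 0, 0, 0, 0, 0, 0;
     0, 1 + a 0 * p 0, a 0 * p 1, a 0 * p 2, 0, 0, 0;
     0, a 1 * p 0, 1 + a 1 * p 1, a 1 * p 2, 0, 0, 0;
     0, a 2 * p 0, a 2 * p 1, 1 + a 2 * p 2, 0, 0, 0;
     0, 0, 0, 0, 1 - p 0 * a 0, -(p 0 * a 1), -(p 0 * a 2);
     0, 0, 0, 0, -(p 1 * a 0), 1 - p 1 * a 1, -(p 1 * a 2);
     0, 0, 0, 0, -(p 2 * a 0), -(p 2 * a 1), 1 - p 2 * a 2]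

theorem lower0_mulVec (w : Fin 3 → ℝ) (X : V7) : lower0 w *ᵥ X =
    ![X 0 - 2 * (w 0 * X 1 + w 1 * X 2 + w 2 * X 3),
      X 1 + (w 1 * X 6 - w 2 * X 5), X 2 + (w 2 * X 4 - w 0 * X 6), X 3 + (w 0 * X 5 - w 1 * X 4),
      X 4 + X 0 * w 0 - (w 0 * X 1 + w 1 * X 2 + w 2 * X 3) * w 0,
      X 5 + X 0 * w 1 - (w 0 * X 1 + w 1 * X 2 + w 2 * X 3) * w 1,
      X 6 + X 0 * w 2 - (w 0 * X 1 + w 1 * X 2 + w 2 * X 3) * w 2] := by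
  simp only [mulVec_eq_vec7, Fin.sum_univ_seven]
  apply vec7_ext <;> simp [lower0] <;> ring

theorem upper0_mulVec (w : Fin 3 → ℝ) (X : V7) : upper0 w *ᵥ X =
    ![X 0 - 2 * (w 0 * X 4 + w 1 * X 5 + w 2 * X 6),
      X 1 + X 0 * w 0 - (w 0 * X 4 + w 1 * X 5 + w 2 * X 6) * w 0,
      X 2 + X 0 * w 1 - (w 0 * X 4 + w 1 * X 5 + w 2 * X 6) * w 1,
      X 3 + X 0 * w 2 - (w 0 * X 4 + w 1 * X 5 + w 2 * X 6) * w 2,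
      X 4 + (w 1 * X 3 - w 2 * X 2), X 5 + (w 2 * X 1 - w 0 * X 3),
      X 6 + (w 0 * X 2 - w 1 * X 1)] := by
  simp only [mulVec_eq_vec7, Fin.sum_univ_seven]
  apply vec7_ext <;> simp [upper0] <;> ring

theorem transvection0_mulVec (a p : Fin 3 → ℝ) (X : V7) : transvection0 a p *ᵥ X =
    ![X 0,
      X 1 + (p 0 * X 1 + p 1 * X 2 + p 2 * X 3) * a 0,
      X 2 + (p 0 * X 1 + p 1 * X 2 + p 2 * X 3) * a 1,
      X 3 + (p 0 * X 1 + p 1 * X 2 + p 2 * X 3) * a 2,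
      X 4 - (a 0 * X 4 + a 1 * X 5 + a 2 * X 6) * p 0,
      X 5 - (a 0 * X 4 + a 1 * X 5 + a 2 * X 6) * p 1,
      X 6 - (a 0 * X 4 + a 1 * X 5 + a 2 * X 6) * p 2] := by
  simp only [mulVec_eq_vec7, Fin.sum_univ_seven]
  apply vec7_ext <;> simp [transvection0] <;> ring

theorem lower0_mem (w : Fin 3 → ℝ) : lower0 w ∈ GSet Omega0 := by
  refine GSet.mem_of_preserves isUnit_gram0 Omega0_eq (fun X Y => ?_) fun X Y => ?_
  · simp only [gram0_apply, lower0_mulVec]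
    simp
    ring
  · simp only [lower0_mulVec]
    apply vec7_ext <;> simp [cross0] <;> ring

theorem upper0_mem (w : Fin 3 → ℝ) : upper0 w ∈ GSet Omega0 := by
  refine GSet.mem_of_preserves isUnit_gram0 Omega0_eq (fun X Y => ?_) fun X Y => ?_
  · simp only [gram0_apply, upper0_mulVec]
    simp
    ring
  · simp only [upper0_mulVec]
    apply vec7_ext <;> simp [cross0] <;> ring

theorem transvection0_mem {a p : Fin 3 → ℝ} (h : a 0 * p 0 + a 1 * p 1 + a 2 * p 2 = 0) :
    transvection0 a p ∈ GSet Omega0 := by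
  refine GSet.mem_of_preserves isUnit_gram0 Omega0_eq (fun X Y => ?_) fun X Y => ?_
  · simp only [gram0_apply, transvection0_mulVec]
    simp
    linear_combination (-(p 0 * X 1 + p 1 * X 2 + p 2 * X 3) * (a 0 * Y 4 + a 1 * Y 5 + a 2 * Y 6)
      - (p 0 * Y 1 + p 1 * Y 2 + p 2 * Y 3) * (a 0 * X 4 + a 1 * X 5 + a 2 * X 6)) * h
  · simp only [transvection0_mulVec]
    apply vec7_ext <;> simp [cross0]
    · linear_combination
        (-2 * (p 0 * X 1 + p 1 * X 2 + p 2 * X 3) * (a 0 * Y 4 + a 1 * Y 5 + a 2 * Y 6)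
        + 2 * (p 0 * Y 1 + p 1 * Y 2 + p 2 * Y 3) * (a 0 * X 4 + a 1 * X 5 + a 2 * X 6)) * h
    · linear_combination 2 * (X 5 * Y 6 - X 6 * Y 5) * h
    · linear_combination 2 * (X 6 * Y 4 - X 4 * Y 6) * h
    · linear_combination 2 * (X 4 * Y 5 - X 5 * Y 4) * h
    · linear_combination 2 * (X 2 * Y 3 - X 3 * Y 2) * h
    · linear_combination 2 * (X 3 * Y 1 - X 1 * Y 3) * h
    · linear_combination 2 * (X 1 * Y 2 - X 2 * Y 1) * h

theorem continuous_lower0 : Continuous lower0 := by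
  unfold lower0
  fun_prop

theorem continuous_upper0 : Continuous upper0 := by
  unfold upper0
  fun_prop

theorem continuous_transvection0 (a p : Fin 3 → ℝ) :
    Continuous fun t : ℝ => transvection0 (t • a) p := by
  unfold transvection0
  simp only [Pi.smul_apply]
  fun_prop

theorem lower0_mem_idComponent (w : Fin 3 → ℝ) : lower0 w ∈ idComponent Omega0 :=
  idComponent.mem_of_family continuous_lower0 lower0_mem (i₀ := 0)
    (by ext i j; fin_cases i <;> fin_cases j <;> simp [lower0]) w

theorem upper0_mem_idComponent (w : Fin 3 → ℝ) : upper0 w ∈ idComponent Omega0 :=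
  idComponent.mem_of_family continuous_upper0 upper0_mem (i₀ := 0)
    (by ext i j; fin_cases i <;> fin_cases j <;> simp [upper0]) w

theorem transvection0_mem_idComponent {a p : Fin 3 → ℝ}
    (h : a 0 * p 0 + a 1 * p 1 + a 2 * p 2 = 0) : transvection0 a p ∈ idComponent Omega0 := by
  have := idComponent.mem_of_family (continuous_transvection0 a p)
    (fun t => transvection0_mem (by simp; linear_combination t * h)) (i₀ := 0)
    (by ext i j; fin_cases i <;> fin_cases j <;> simp [transvection0]) 1
  simpa using this

theorem exists_idComponent0_of_upper_ne_zero {X : V7}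
    (hX : X 0 ^ 2 + 4 * (X 1 * X 4 + X 2 * X 5 + X 3 * X 6) = 1)
    (hu : X 1 ^ 2 + X 2 ^ 2 + X 3 ^ 2 ≠ 0) :
    ∃ U ∈ idComponent Omega0, U *ᵥ X = ![1, 0, 0, 0, 0, 0, 0] := by
  have hlast : ∀ Y : V7, Y 0 = 1 → Y 0 ^ 2 + 4 * (Y 1 * Y 4 + Y 2 * Y 5 + Y 3 * Y 6) = 1 →
      ∃ U ∈ idComponent Omega0, U *ᵥ Y = ![1, 0, 0, 0, 0, 0, 0] := by
    intro Y h0 hY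
    have h : Y 4 * Y 1 + Y 5 * Y 2 + Y 6 * Y 3 = 0 := by rw [h0] at hY; linarith
    refine ⟨upper0 ![-Y 1, -Y 2, -Y 3] * lower0 ![-Y 4, -Y 5, -Y 6],
      idComponent.mul_mem (upper0_mem_idComponent _) (lower0_mem_idComponent _), ?_⟩
    have h1 : lower0 ![-Y 4, -Y 5, -Y 6] *ᵥ Y = ![1, Y 1, Y 2, Y 3, 0, 0, 0] := by
      rw [lower0_mulVec]
      have h' : -(Y 4 * Y 1) + -(Y 5 * Y 2) + -(Y 6 * Y 3) = 0 := by linarith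
      apply vec7_ext <;> simp [h0, h']
      all_goals ring
    rw [← mulVec_mulVec, h1, upper0_mulVec]
    apply vec7_ext <;> simp <;> ring
  set k := (X 0 - 1) / (2 * (X 1 ^ 2 + X 2 ^ 2 + X 3 ^ 2)) with hk
  have hk' : 2 * k * (X 1 ^ 2 + X 2 ^ 2 + X 3 ^ 2) = X 0 - 1 := by
    rw [hk]; field_simp
  obtain ⟨U, hU, h⟩ := hlast (lower0 ![k * X 1, k * X 2, k * X 3] *ᵥ X)
    (by rw [lower0_mulVec]; simp; linear_combination -hk')
    (by rw [lower0_mulVec]; simp; linear_combination hX)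
  exact ⟨_, idComponent.mul_mem hU (lower0_mem_idComponent _), by rw [← mulVec_mulVec, h]⟩

theorem exists_idComponent0_mulVec_eq_e0 {X : V7}
    (hX : X 0 ^ 2 + 4 * (X 1 * X 4 + X 2 * X 5 + X 3 * X 6) = 1) :
    ∃ U ∈ idComponent Omega0, U *ᵥ X = ![1, 0, 0, 0, 0, 0, 0] := by
  by_cases hu : X 1 ^ 2 + X 2 ^ 2 + X 3 ^ 2 = 0
  · have h1 : X 1 = 0 := by nlinarith [sq_nonneg (X 1), sq_nonneg (X 2), sq_nonneg (X 3)]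
    have h2 : X 2 = 0 := by nlinarith [sq_nonneg (X 1), sq_nonneg (X 2), sq_nonneg (X 3)]
    have h3 : X 3 = 0 := by nlinarith [sq_nonneg (X 1), sq_nonneg (X 2), sq_nonneg (X 3)]
    have h0 : X 0 ^ 2 = 1 := by rw [h1, h2, h3] at hX; linarith
    have key : ∀ t : ℝ, t * X 0 - t * X 4 * t ≠ 0 →
        ∃ U ∈ idComponent Omega0, U *ᵥ X = ![1, 0, 0, 0, 0, 0, 0] := by
      intro t ht
      obtain ⟨U, hU, h⟩ := exists_idComponent0_of_upper_ne_zero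
        (X := upper0 ![t, 0, 0] *ᵥ X)
        (by rw [upper0_mulVec]; simp [h1, h2, h3]; linear_combination h0)
        (by
          rw [upper0_mulVec]; simp [h1, h2, h3]
          intro h; exact ht (by linear_combination h))
      exact ⟨_, idComponent.mul_mem hU (upper0_mem_idComponent _), by rw [← mulVec_mulVec, h]⟩
    by_cases h : 1 * X 0 - 1 * X 4 * 1 = 0
    · refine key (-1) fun h' => ?_
      have : X 0 = 0 := by linarith
      simp [this] at h0
    · exact key 1 h
  · exact exists_idComponent0_of_upper_ne_zero hX hu

theorem exists_idComponent0_mulVec_eq_e1 {p q r : ℝ} (h : ¬(p = 0 ∧ q = 0 ∧ r = 0)) :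
    ∃ U ∈ idComponent Omega0, U *ᵥ ![1, 0, 0, 0, 0, 0, 0] = ![1, 0, 0, 0, 0, 0, 0] ∧
      U *ᵥ ![0, p, q, r, 0, 0, 0] = ![0, 1, 0, 0, 0, 0, 0] := by
  have key : ∀ p q r y z : ℝ, p + y * q + z * r = 1 →
      ∃ U ∈ idComponent Omega0, U *ᵥ ![1, 0, 0, 0, 0, 0, 0] = ![1, 0, 0, 0, 0, 0, 0] ∧
        U *ᵥ ![0, p, q, r, 0, 0, 0] = ![0, 1, 0, 0, 0, 0, 0] := by
    intro p q r y z h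
    refine ⟨transvection0 ![1 - p, -q, -r] ![1, y, z],
      transvection0_mem_idComponent (by simp; linear_combination -h), ?_, ?_⟩ <;>
    rw [transvection0_mulVec] <;> apply vec7_ext <;> simp [h]
  by_cases hq : q = 0
  · by_cases hr : r = 0
    · have hp : p ≠ 0 := fun hp => h ⟨hp, hq, hr⟩
      obtain ⟨U, hU, h0, h1⟩ := key p p r ((1 - p) / p) 0 (by field_simp; ring)
      refine ⟨U * transvection0 ![0, 1, 0] ![1, 0, 0],
        idComponent.mul_mem hU (transvection0_mem_idComponent (by simp)), ?_, ?_⟩ <;>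
      rw [← mulVec_mulVec, transvection0_mulVec]
      · simpa using h0
      · simpa [hq] using h1
    · exact key p q r 0 ((1 - p) / r) (by field_simp; ring)
  · exact key p q r ((1 - p) / q) 0 (by field_simp; ring)

theorem exists_idComponent0_mulVec_eq_e2 {p q r : ℝ} (h : ¬(q = 0 ∧ r = 0)) :
    ∃ U ∈ idComponent Omega0, U *ᵥ ![1, 0, 0, 0, 0, 0, 0] = ![1, 0, 0, 0, 0, 0, 0] ∧
      U *ᵥ ![0, 1, 0, 0, 0, 0, 0] = ![0, 1, 0, 0, 0, 0, 0] ∧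
      U *ᵥ ![0, p, q, r, 0, 0, 0] = ![0, 0, 1, 0, 0, 0, 0] := by
  have key : ∀ r z : ℝ, q + z * r = 1 →
      ∃ U ∈ idComponent Omega0, U *ᵥ ![1, 0, 0, 0, 0, 0, 0] = ![1, 0, 0, 0, 0, 0, 0] ∧
        U *ᵥ ![0, 1, 0, 0, 0, 0, 0] = ![0, 1, 0, 0, 0, 0, 0] ∧
        U *ᵥ ![0, p, q, r, 0, 0, 0] = ![0, 0, 1, 0, 0, 0, 0] := by
    intro r z h
    refine ⟨transvection0 ![-p, 1 - q, -r] ![0, 1, z],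
      transvection0_mem_idComponent (by simp; linear_combination -h), ?_, ?_, ?_⟩ <;>
    rw [transvection0_mulVec] <;> apply vec7_ext <;> simp [h]
  by_cases hr : r = 0
  · have hq : q ≠ 0 := fun hq => h ⟨hq, hr⟩
    obtain ⟨U, hU, h0, h1, h2⟩ := key q ((1 - q) / q) (by field_simp; ring)
    refine ⟨U * transvection0 ![0, 0, 1] ![0, 1, 0],
      idComponent.mul_mem hU (transvection0_mem_idComponent (by simp)), ?_, ?_, ?_⟩ <;>
    rw [← mulVec_mulVec, transvection0_mulVec]
    · simpa using h0
    · simpa using h1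
    · simpa [hr] using h2
  · exact key r ((1 - q) / r) (by field_simp; ring)

theorem exists_idComponent0_mulVec_eq_e3 (p q : ℝ) :
    ∃ U ∈ idComponent Omega0, U *ᵥ ![1, 0, 0, 0, 0, 0, 0] = ![1, 0, 0, 0, 0, 0, 0] ∧
      U *ᵥ ![0, 1, 0, 0, 0, 0, 0] = ![0, 1, 0, 0, 0, 0, 0] ∧
      U *ᵥ ![0, 0, 1, 0, 0, 0, 0] = ![0, 0, 1, 0, 0, 0, 0] ∧
      U *ᵥ ![0, p, q, 1, 0, 0, 0] = ![0, 0, 0, 1, 0, 0, 0] := by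
  refine ⟨transvection0 ![-p, -q, 0] ![0, 0, 1],
    transvection0_mem_idComponent (by simp), ?_, ?_, ?_, ?_⟩ <;>
  rw [transvection0_mulVec] <;> apply vec7_ext <;> simp

set_option maxHeartbeats 1000000 in
theorem IsInfinitesimalSymmetry.skew0 {D : M7} (hD : IsInfinitesimalSymmetry Omega0 D) :
    Dᵀ * gram0 + gram0 * D = 0 := by
  have h := fun i j k => hD (Pi.single i 1) (Pi.single j 1) (Pi.single k 1)
  simp only [Omega0_eq, gram0_apply] at h
  simp only [mulVec_single_one] at h
  have h012 := h 0 1 2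
  have h013 := h 0 1 3
  have h014 := h 0 1 4
  have h015 := h 0 1 5
  have h016 := h 0 1 6
  have h023 := h 0 2 3
  have h024 := h 0 2 4
  have h025 := h 0 2 5
  have h026 := h 0 2 6
  have h034 := h 0 3 4
  have h035 := h 0 3 5
  have h036 := h 0 3 6
  have h045 := h 0 4 5
  have h046 := h 0 4 6
  have h056 := h 0 5 6
  have h123 := h 1 2 3
  have h124 := h 1 2 4
  have h125 := h 1 2 5
  have h126 := h 1 2 6
  have h134 := h 1 3 4
  have h135 := h 1 3 5
  have h136 := h 1 3 6
  have h145 := h 1 4 5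
  have h146 := h 1 4 6
  have h156 := h 1 5 6
  have h234 := h 2 3 4
  have h235 := h 2 3 5
  have h236 := h 2 3 6
  have h245 := h 2 4 5
  have h246 := h 2 4 6
  have h256 := h 2 5 6
  have h345 := h 3 4 5
  have h346 := h 3 4 6
  have h356 := h 3 5 6
  have h456 := h 4 5 6
  clear h hD
  simp [cross0] at *
  ext i j
  simp only [Matrix.add_apply, Matrix.mul_apply, Fin.sum_univ_seven]
  fin_cases i <;> fin_cases j <;> simp [gram0] <;> linarith

theorem eq_smul_gram0 {T : M7} (hT : Tᵀ = T)
    (h : ∀ D, IsInfinitesimalSymmetry Omega0 D → Dᵀ * T + T * D = 0) :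
    ∃ c : ℝ, T = c • gram0 := by
  have hs : ∀ i j, T i j = T j i := fun i j => congrFun₂ hT j i
  obtain ⟨d, hd⟩ : ∃ d : V7, d = ![0, 1, 2, -3, -1, -2, 3] := ⟨_, rfl⟩
  have hz : ∀ i j, d i + d j ≠ 0 → T i j = 0 := by
    have := h (diagonal d) fun X Y Z => by
      simp only [Omega0_eq, gram0_apply, mulVec_diagonal]
      simp [cross0, mulVec_diagonal, hd]
      ring
    intro i j hij
    have := congrFun₂ this i j
    simp at this
    exact (mul_eq_zero.1 (by linear_combination this : (d i + d j) * T i j = 0)).resolve_left hij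
  have hl := h !![0, -2, -2, -2, 0, 0, 0; 0, 0, 0, 0, 0, -1, 1; 0, 0, 0, 0, 1, 0, -1;
      0, 0, 0, 0, -1, 1, 0; 1, 0, 0, 0, 0, 0, 0; 1, 0, 0, 0, 0, 0, 0; 1, 0, 0, 0, 0, 0, 0] (by
    intro X Y Z
    simp only [Omega0_eq, gram0_apply]
    simp only [mulVec_eq_vec7, Fin.sum_univ_seven]
    simp [cross0]
    ring)
  have h1 := congrFun₂ hl 0 1
  have h2 := congrFun₂ hl 0 2
  have h3 := congrFun₂ hl 0 3
  simp [Matrix.mul_apply, Fin.sum_univ_seven] at h1 h2 h3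
  rw [hz 5 1 (by simp [hd]; norm_num), hz 6 1 (by simp [hd]; norm_num), hs 4 1] at h1
  rw [hz 4 2 (by simp [hd]; norm_num), hz 6 2 (by simp [hd]; norm_num), hs 5 2] at h2
  rw [hz 4 3 (by simp [hd]; norm_num), hz 5 3 (by simp [hd]; norm_num), hs 6 3] at h3
  refine ⟨-T 0 0, ?_⟩
  ext i j
  fin_cases i <;> fin_cases j <;> simp [gram0] <;>
    first
    | exact hz _ _ (by simp [hd] <;> norm_num)
    | linarith [hs 4 1, hs 5 2, hs 6 3]

theorem GSet.preserves0 {A : M7} (hA : A ∈ GSet Omega0) :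
    (∀ X Y, (A *ᵥ X) ⬝ᵥ gram0 *ᵥ (A *ᵥ Y) = X ⬝ᵥ gram0 *ᵥ Y) ∧
      ∀ X Y, cross0 (A *ᵥ X) (A *ᵥ Y) = A *ᵥ cross0 X Y :=
  GSet.preserves_form_and_cross isUnit_gram0
    (by ext i j; fin_cases i <;> fin_cases j <;> simp [gram0]) Omega0_eq cross0_gram0
    (fun _ => IsInfinitesimalSymmetry.skew0) (fun _ => eq_smul_gram0)
    (X₀ := ![0, 1, 0, 0, 0, 0, 0]) (Y₀ := ![0, 0, 0, 0, 1, 0, 0])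
    (by rw [gram0_apply]; simp [cross0]) hA

theorem GSet.eq_one_of_fixes0 {A : M7} (hA : A ∈ GSet Omega0)
    (h0 : A *ᵥ ![1, 0, 0, 0, 0, 0, 0] = ![1, 0, 0, 0, 0, 0, 0])
    (h1 : A *ᵥ ![0, 1, 0, 0, 0, 0, 0] = ![0, 1, 0, 0, 0, 0, 0])
    (h2 : A *ᵥ ![0, 0, 1, 0, 0, 0, 0] = ![0, 0, 1, 0, 0, 0, 0])
    (h3 : A *ᵥ ![0, 0, 0, 1, 0, 0, 0] = ![0, 0, 0, 1, 0, 0, 0]) : A = 1 := by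
  have hC := (GSet.preserves0 hA).2
  have h4 := hC ![0, 0, 1, 0, 0, 0, 0] ![0, 0, 0, 1, 0, 0, 0]
  have h5 := hC ![0, 0, 0, 1, 0, 0, 0] ![0, 1, 0, 0, 0, 0, 0]
  have h6 := hC ![0, 1, 0, 0, 0, 0, 0] ![0, 0, 1, 0, 0, 0, 0]
  rw [h2, h3] at h4
  rw [h3, h1] at h5
  rw [h1, h2] at h6
  ext i j
  replace h0 := congrFun h0 i
  replace h1 := congrFun h1 i
  replace h2 := congrFun h2 i
  replace h3 := congrFun h3 i
  replace h4 := congrFun h4 i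
  replace h5 := congrFun h5 i
  replace h6 := congrFun h6 i
  clear hC
  simp only [mulVec, dotProduct, Fin.sum_univ_seven] at h0 h1 h2 h3 h4 h5 h6
  simp [cross0] at h0 h1 h2 h3 h4 h5 h6
  fin_cases j <;> simp [*] <;> fin_cases i <;> simp at * <;> linarith

theorem cross0_e0_eq_self {Y : V7} (h : cross0 ![1, 0, 0, 0, 0, 0, 0] Y = Y) :
    Y = ![0, Y 1, Y 2, Y 3, 0, 0, 0] := by
  have h0 := congrFun h 0
  have h4 := congrFun h 4
  have h5 := congrFun h 5
  have h6 := congrFun h 6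
  simp [cross0] at h0 h4 h5 h6
  apply vec7_ext <;> simp <;> linarith

theorem isConnected_GSet_Omega0 : IsConnected (GSet Omega0) := by
  have fix3 : ∀ A ∈ GSet Omega0, A *ᵥ ![1, 0, 0, 0, 0, 0, 0] = ![1, 0, 0, 0, 0, 0, 0] →
      A *ᵥ ![0, 1, 0, 0, 0, 0, 0] = ![0, 1, 0, 0, 0, 0, 0] →
      A *ᵥ ![0, 0, 1, 0, 0, 0, 0] = ![0, 0, 1, 0, 0, 0, 0] →
      ∃ V ∈ idComponent Omega0, V * A = 1 := by
    intro A hA h0 h1 h2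
    obtain ⟨hN, hC⟩ := GSet.preserves0 hA
    have hY := cross0_e0_eq_self (Y := A *ᵥ ![0, 0, 0, 1, 0, 0, 0])
      (by rw [← h0, hC]; congr 1; simp [cross0])
    have h6 := hC ![0, 1, 0, 0, 0, 0, 0] ![0, 0, 1, 0, 0, 0, 0]
    have hn := hN ![0, 0, 0, 1, 0, 0, 0]
      (cross0 ![0, 1, 0, 0, 0, 0, 0] ![0, 0, 1, 0, 0, 0, 0])
    rw [← h6, h1, h2, hY, gram0_apply, gram0_apply] at hn
    simp [cross0] at hn
    rw [hn] at hY
    obtain ⟨U, hU, k0, k1, k2, k3⟩ := exists_idComponent0_mulVec_eq_e3 _ _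
    exact ⟨U, hU, GSet.eq_one_of_fixes0 (GSet.mul_mem hU.1 hA) (by rw [← mulVec_mulVec, h0, k0])
      (by rw [← mulVec_mulVec, h1, k1]) (by rw [← mulVec_mulVec, h2, k2])
      (by rw [← mulVec_mulVec, hY, k3])⟩
  have fix2 : ∀ A ∈ GSet Omega0, A *ᵥ ![1, 0, 0, 0, 0, 0, 0] = ![1, 0, 0, 0, 0, 0, 0] →
      A *ᵥ ![0, 1, 0, 0, 0, 0, 0] = ![0, 1, 0, 0, 0, 0, 0] →
      ∃ V ∈ idComponent Omega0, V * A = 1 := by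
    intro A hA h0 h1
    obtain ⟨hN, hC⟩ := GSet.preserves0 hA
    have hY := cross0_e0_eq_self (Y := A *ᵥ ![0, 0, 1, 0, 0, 0, 0])
      (by rw [← h0, hC]; congr 1; simp [cross0])
    obtain ⟨U, hU, k0, k1, k2⟩ := exists_idComponent0_mulVec_eq_e2
      (p := (A *ᵥ ![0, 0, 1, 0, 0, 0, 0]) 1) (q := (A *ᵥ ![0, 0, 1, 0, 0, 0, 0]) 2)
      (r := (A *ᵥ ![0, 0, 1, 0, 0, 0, 0]) 3) (by
        rintro ⟨hq, hr⟩
        have hn1 := hN ![0, 1, 0, 0, 0, 0, 0] ![0, 0, 0, 0, 0, 1, 0]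
        have hn2 := hN ![0, 0, 1, 0, 0, 0, 0] ![0, 0, 0, 0, 0, 1, 0]
        rw [h1] at hn1
        rw [hY, hq, hr] at hn2
        simp only [gram0_apply] at hn1 hn2
        simp at hn1 hn2
        rw [hn1] at hn2
        simp at hn2)
    rw [← hY] at k2
    exact idComponent.exists_mul_eq_one hU
      (fix3 _ (GSet.mul_mem hU.1 hA) (by rw [← mulVec_mulVec, h0, k0])
      (by rw [← mulVec_mulVec, h1, k1]) (by rw [← mulVec_mulVec, k2]))
  have fix1 : ∀ A ∈ GSet Omega0, A *ᵥ ![1, 0, 0, 0, 0, 0, 0] = ![1, 0, 0, 0, 0, 0, 0] →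
      ∃ V ∈ idComponent Omega0, V * A = 1 := by
    intro A hA h0
    obtain ⟨hN, hC⟩ := GSet.preserves0 hA
    have hY := cross0_e0_eq_self (Y := A *ᵥ ![0, 1, 0, 0, 0, 0, 0])
      (by rw [← h0, hC]; congr 1; simp [cross0])
    obtain ⟨U, hU, k0, k1⟩ := exists_idComponent0_mulVec_eq_e1
      (p := (A *ᵥ ![0, 1, 0, 0, 0, 0, 0]) 1) (q := (A *ᵥ ![0, 1, 0, 0, 0, 0, 0]) 2)
      (r := (A *ᵥ ![0, 1, 0, 0, 0, 0, 0]) 3) (by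
        rintro ⟨hp, hq, hr⟩
        have hn := hN ![0, 1, 0, 0, 0, 0, 0] ![0, 0, 0, 0, 1, 0, 0]
        rw [hY, hp, hq, hr] at hn
        simp only [gram0_apply] at hn
        simp at hn)
    rw [← hY] at k1
    exact idComponent.exists_mul_eq_one hU
      (fix2 _ (GSet.mul_mem hU.1 hA) (by rw [← mulVec_mulVec, h0, k0])
      (by rw [← mulVec_mulVec, k1]))
  refine GSet.isConnected_of_reduction fun A hA => ?_
  have hn := (GSet.preserves0 hA).1 ![1, 0, 0, 0, 0, 0, 0] ![1, 0, 0, 0, 0, 0, 0]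
  rw [gram0_apply, gram0_apply] at hn
  obtain ⟨U, hU, k0⟩ := exists_idComponent0_mulVec_eq_e0 (X := A *ᵥ ![1, 0, 0, 0, 0, 0, 0])
    (by simp only [cons_val] at hn; linear_combination -hn)
  exact idComponent.exists_mul_eq_one hU
      (fix1 _ (GSet.mul_mem hU.1 hA) (by rw [← mulVec_mulVec, k0]))

/-- The cross product associated to `Ω₁` and the standard inner product. -/
def cross1 (X Y : V7) : V7 :=
  ![(X 3 * Y 6 - X 6 * Y 3) + (X 1 * Y 2 - X 2 * Y 1) - (X 4 * Y 5 - X 5 * Y 4),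
    (X 4 * Y 6 - X 6 * Y 4) + (X 2 * Y 0 - X 0 * Y 2) + (X 3 * Y 5 - X 5 * Y 3),
    (X 5 * Y 6 - X 6 * Y 5) + (X 0 * Y 1 - X 1 * Y 0) - (X 3 * Y 4 - X 4 * Y 3),
    (X 6 * Y 0 - X 0 * Y 6) + (X 5 * Y 1 - X 1 * Y 5) - (X 4 * Y 2 - X 2 * Y 4),
    (X 6 * Y 1 - X 1 * Y 6) - (X 5 * Y 0 - X 0 * Y 5) - (X 2 * Y 3 - X 3 * Y 2),
    (X 6 * Y 2 - X 2 * Y 6) - (X 0 * Y 4 - X 4 * Y 0) + (X 1 * Y 3 - X 3 * Y 1),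
    (X 0 * Y 3 - X 3 * Y 0) + (X 1 * Y 4 - X 4 * Y 1) + (X 2 * Y 5 - X 5 * Y 2)]

theorem gram1_apply (X Y : V7) : X ⬝ᵥ (1 : M7) *ᵥ Y =
    X 0 * Y 0 + X 1 * Y 1 + X 2 * Y 2 + X 3 * Y 3 + X 4 * Y 4 + X 5 * Y 5 + X 6 * Y 6 := by
  rw [one_mulVec, dotProduct, Fin.sum_univ_seven]

theorem Omega1_eq (X Y Z : V7) : Omega1 X Y Z = cross1 X Y ⬝ᵥ (1 : M7) *ᵥ Z := by
  rw [gram1_apply]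
  simp [Omega1, eee, det_fin_three, cross1]
  ring

theorem cross1_gram1 (X Y : V7) : cross1 X Y ⬝ᵥ (1 : M7) *ᵥ cross1 X Y =
    (X ⬝ᵥ (1 : M7) *ᵥ X) * (Y ⬝ᵥ (1 : M7) *ᵥ Y) - (X ⬝ᵥ (1 : M7) *ᵥ Y) ^ 2 := by
  simp only [gram1_apply]
  simp [cross1]
  ring

/-- The action of the unit quaternion `w` on the second and third factors of
`ℝ⁷ = ℂ³ × ℝ`, as an element of `SU(2)`. -/
def rot23 (w : Fin 4 → ℝ) : M7 :=
  !![1, 0, 0, 0, 0, 0, 0;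
     0, w 0, -w 2, 0, -w 1, -w 3, 0;
     0, w 2, w 0, 0, -w 3, w 1, 0;
     0, 0, 0, 1, 0, 0, 0;
     0, w 1, w 3, 0, w 0, -w 2, 0;
     0, w 3, -w 1, 0, w 2, w 0, 0;
     0, 0, 0, 0, 0, 0, 1]

/-- The action of the unit quaternion `w` on the first and second factors of
`ℝ⁷ = ℂ³ × ℝ`, as an element of `SU(2)`. -/
def rot12 (w : Fin 4 → ℝ) : M7 :=
  !![w 0, -w 2, 0, -w 1, -w 3, 0, 0;
     w 2, w 0, 0, -w 3, w 1, 0, 0;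
     0, 0, 1, 0, 0, 0, 0;
     w 1, w 3, 0, w 0, -w 2, 0, 0;
     w 3, -w 1, 0, w 2, w 0, 0, 0;
     0, 0, 0, 0, 0, 1, 0;
     0, 0, 0, 0, 0, 0, 1]

/-- The simultaneous rotation of the planes spanned by `e₀, e₆` and by `e₁, e₅`. -/
def rot06 (w : Fin 2 → ℝ) : M7 :=
  !![w 0, 0, 0, 0, 0, 0, w 1;
     0, w 0, 0, 0, 0, -w 1, 0;
     0, 0, 1, 0, 0, 0, 0;
     0, 0, 0, 1, 0, 0, 0;
     0, 0, 0, 0, 1, 0, 0;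
     0, w 1, 0, 0, 0, w 0, 0;
     -w 1, 0, 0, 0, 0, 0, w 0]

theorem rot23_mulVec (w : Fin 4 → ℝ) (X : V7) : rot23 w *ᵥ X =
    ![X 0, w 0 * X 1 - w 2 * X 2 - w 1 * X 4 - w 3 * X 5,
      w 2 * X 1 + w 0 * X 2 - w 3 * X 4 + w 1 * X 5, X 3,
      w 1 * X 1 + w 3 * X 2 + w 0 * X 4 - w 2 * X 5,
      w 3 * X 1 - w 1 * X 2 + w 2 * X 4 + w 0 * X 5, X 6] := by
  simp only [mulVec_eq_vec7, Fin.sum_univ_seven]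
  apply vec7_ext <;> simp [rot23] <;> ring

theorem rot12_mulVec (w : Fin 4 → ℝ) (X : V7) : rot12 w *ᵥ X =
    ![w 0 * X 0 - w 2 * X 1 - w 1 * X 3 - w 3 * X 4,
      w 2 * X 0 + w 0 * X 1 - w 3 * X 3 + w 1 * X 4, X 2,
      w 1 * X 0 + w 3 * X 1 + w 0 * X 3 - w 2 * X 4,
      w 3 * X 0 - w 1 * X 1 + w 2 * X 3 + w 0 * X 4, X 5, X 6] := by
  simp only [mulVec_eq_vec7, Fin.sum_univ_seven]
  apply vec7_ext <;> simp [rot12] <;> ring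

theorem rot06_mulVec (w : Fin 2 → ℝ) (X : V7) : rot06 w *ᵥ X =
    ![w 0 * X 0 + w 1 * X 6, w 0 * X 1 - w 1 * X 5, X 2, X 3, X 4, w 1 * X 1 + w 0 * X 5,
      w 0 * X 6 - w 1 * X 0] := by
  simp only [mulVec_eq_vec7, Fin.sum_univ_seven]
  apply vec7_ext <;> simp [rot06] <;> ring

theorem rot23_mem {w : Fin 4 → ℝ} (h : ∑ i, w i ^ 2 = 1) : rot23 w ∈ GSet Omega1 := by
  rw [Fin.sum_univ_four] at h
  refine GSet.mem_of_preserves isUnit_one Omega1_eq (fun X Y => ?_) fun X Y => ?_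
  · simp only [gram1_apply, rot23_mulVec]
    simp
    linear_combination (X 1 * Y 1 + X 2 * Y 2 + X 4 * Y 4 + X 5 * Y 5) * h
  · simp only [rot23_mulVec]
    apply vec7_ext <;> simp [cross1]
    · linear_combination (X 1 * Y 2 - X 2 * Y 1 - (X 4 * Y 5 - X 5 * Y 4)) * h
    · ring
    · ring
    · linear_combination (X 5 * Y 1 - X 1 * Y 5 - (X 4 * Y 2 - X 2 * Y 4)) * h
    · ring
    · ring
    · linear_combination (X 1 * Y 4 - X 4 * Y 1 + (X 2 * Y 5 - X 5 * Y 2)) * h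

theorem rot12_mem {w : Fin 4 → ℝ} (h : ∑ i, w i ^ 2 = 1) : rot12 w ∈ GSet Omega1 := by
  rw [Fin.sum_univ_four] at h
  refine GSet.mem_of_preserves isUnit_one Omega1_eq (fun X Y => ?_) fun X Y => ?_
  · simp only [gram1_apply, rot12_mulVec]
    simp
    linear_combination (X 0 * Y 0 + X 1 * Y 1 + X 3 * Y 3 + X 4 * Y 4) * h
  · simp only [rot12_mulVec]
    apply vec7_ext <;> simp [cross1]
    · ring
    · ring
    · linear_combination (X 0 * Y 1 - X 1 * Y 0 - (X 3 * Y 4 - X 4 * Y 3)) * h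
    · ring
    · ring
    · linear_combination (X 1 * Y 3 - X 3 * Y 1 - (X 0 * Y 4 - X 4 * Y 0)) * h
    · linear_combination (X 0 * Y 3 - X 3 * Y 0 + (X 1 * Y 4 - X 4 * Y 1)) * h

theorem rot06_mem {w : Fin 2 → ℝ} (h : ∑ i, w i ^ 2 = 1) : rot06 w ∈ GSet Omega1 := by
  rw [Fin.sum_univ_two] at h
  refine GSet.mem_of_preserves isUnit_one Omega1_eq (fun X Y => ?_) fun X Y => ?_
  · simp only [gram1_apply, rot06_mulVec]
    simp
    linear_combination (X 0 * Y 0 + X 1 * Y 1 + X 5 * Y 5 + X 6 * Y 6) * h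
  · simp only [rot06_mulVec]
    apply vec7_ext <;> simp [cross1]
    · ring
    · ring
    · linear_combination (X 5 * Y 6 - X 6 * Y 5 + (X 0 * Y 1 - X 1 * Y 0)) * h
    · linear_combination (X 6 * Y 0 - X 0 * Y 6 + (X 5 * Y 1 - X 1 * Y 5)) * h
    · linear_combination (X 6 * Y 1 - X 1 * Y 6 - (X 5 * Y 0 - X 0 * Y 5)) * h
    · ring
    · ring

/-- A family of symmetries parametrized by a sphere of positive dimension and passing through the
identity lies in the identity component. -/
theorem idComponent.mem_of_sphere_family {Ω : V7 → V7 → V7 → ℝ} {n : ℕ} (hn : 2 ≤ n)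
    {f : (Fin n → ℝ) → M7} (hf : Continuous f) (hG : ∀ w, ∑ i, w i ^ 2 = 1 → f w ∈ GSet Ω)
    {w₀ : Fin n → ℝ} (hw₀ : ∑ i, w₀ i ^ 2 = 1) (h₀ : f w₀ = 1) {w : Fin n → ℝ}
    (hw : ∑ i, w i ^ 2 = 1) : f w ∈ idComponent Ω := by
  have hS : ∀ v : EuclideanSpace ℝ (Fin n),
      v ∈ Metric.sphere (0 : EuclideanSpace ℝ (Fin n)) 1 ↔ ∑ i, v i ^ 2 = 1 := fun v => by
    rw [mem_sphere_zero_iff_norm, EuclideanSpace.norm_eq, Real.sqrt_eq_one]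
    simp
  have : PreconnectedSpace (Metric.sphere (0 : EuclideanSpace ℝ (Fin n)) 1) :=
    Subtype.preconnectedSpace (isPreconnected_sphere (by
      rw [← Module.finrank_eq_rank, finrank_euclideanSpace_fin]
      exact_mod_cast hn) 0 1)
  exact idComponent.mem_of_family
    (f := fun v : Metric.sphere (0 : EuclideanSpace ℝ (Fin n)) 1 => f v.1.ofLp)
    (hf.comp (by fun_prop)) (fun v => hG _ ((hS v).1 v.2))
    (i₀ := ⟨WithLp.toLp 2 w₀, (hS _).2 hw₀⟩) h₀ ⟨WithLp.toLp 2 w, (hS _).2 hw⟩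

theorem rot23_mem_idComponent {w : Fin 4 → ℝ} (h : ∑ i, w i ^ 2 = 1) :
    rot23 w ∈ idComponent Omega1 :=
  idComponent.mem_of_sphere_family (by norm_num) (by unfold rot23; fun_prop)
    (fun _ => rot23_mem) (w₀ := ![1, 0, 0, 0]) (by simp [Fin.sum_univ_four])
    (by ext i j; fin_cases i <;> fin_cases j <;> simp [rot23]) h

theorem rot12_mem_idComponent {w : Fin 4 → ℝ} (h : ∑ i, w i ^ 2 = 1) :
    rot12 w ∈ idComponent Omega1 :=
  idComponent.mem_of_sphere_family (by norm_num) (by unfold rot12; fun_prop)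
    (fun _ => rot12_mem) (w₀ := ![1, 0, 0, 0]) (by simp [Fin.sum_univ_four])
    (by ext i j; fin_cases i <;> fin_cases j <;> simp [rot12]) h

theorem rot06_mem_idComponent {w : Fin 2 → ℝ} (h : ∑ i, w i ^ 2 = 1) :
    rot06 w ∈ idComponent Omega1 :=
  idComponent.mem_of_sphere_family (by norm_num) (by unfold rot06; fun_prop)
    (fun _ => rot06_mem) (w₀ := ![1, 0]) (by simp)
    (by ext i j; fin_cases i <;> fin_cases j <;> simp [rot06]) h

theorem exists_eq_smul_unit {n : ℕ} (v : Fin (n + 1) → ℝ) :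
    ∃ r : ℝ, 0 ≤ r ∧ ∃ w : Fin (n + 1) → ℝ, ∑ i, w i ^ 2 = 1 ∧ v = r • w := by
  have h0 : 0 ≤ ∑ i, v i ^ 2 := Finset.sum_nonneg fun i _ => sq_nonneg _
  by_cases h : ∑ i, v i ^ 2 = 0
  · refine ⟨0, le_rfl, Pi.single 0 1, by simp [Pi.single_apply], ?_⟩
    ext i
    simpa using (Finset.sum_eq_zero_iff_of_nonneg fun i _ => sq_nonneg _).1 h i
  · have hr : √(∑ i, v i ^ 2) ≠ 0 := (Real.sqrt_ne_zero h0).2 h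
    refine ⟨_, Real.sqrt_nonneg (∑ i, v i ^ 2), (√(∑ i, v i ^ 2))⁻¹ • v, ?_, ?_⟩
    · simp only [Pi.smul_apply, smul_eq_mul, mul_pow, ← Finset.mul_sum, inv_pow, Real.sq_sqrt h0]
      exact inv_mul_cancel₀ h
    · rw [smul_smul, mul_inv_cancel₀ hr, one_smul]

theorem exists_rot23_mulVec_eq (X : V7) :
    ∃ r : ℝ, 0 ≤ r ∧ ∃ w : Fin 4 → ℝ, ∑ i, w i ^ 2 = 1 ∧
      rot23 w *ᵥ X = ![X 0, r, 0, X 3, 0, 0, X 6] := by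
  obtain ⟨r, hr, w, hw, h⟩ := exists_eq_smul_unit ![X 1, -X 4, -X 2, -X 5]
  refine ⟨r, hr, w, hw, ?_⟩
  have h0 := congrFun h 0
  have h1 := congrFun h 1
  have h2 := congrFun h 2
  have h3 := congrFun h 3
  simp [neg_eq_iff_eq_neg] at h0 h1 h2 h3
  rw [Fin.sum_univ_four] at hw
  rw [rot23_mulVec]
  apply vec7_ext <;> simp [h0, h1, h2, h3]
  · linear_combination r * hw
  all_goals ring

theorem exists_rot12_mulVec_eq (X : V7) :
    ∃ r : ℝ, 0 ≤ r ∧ ∃ w : Fin 4 → ℝ, ∑ i, w i ^ 2 = 1 ∧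
      rot12 w *ᵥ X = ![r, 0, X 2, 0, 0, X 5, X 6] := by
  obtain ⟨r, hr, w, hw, h⟩ := exists_eq_smul_unit ![X 0, -X 3, -X 1, -X 4]
  refine ⟨r, hr, w, hw, ?_⟩
  have h0 := congrFun h 0
  have h1 := congrFun h 1
  have h2 := congrFun h 2
  have h3 := congrFun h 3
  simp [neg_eq_iff_eq_neg] at h0 h1 h2 h3
  rw [Fin.sum_univ_four] at hw
  rw [rot12_mulVec]
  apply vec7_ext <;> simp [h0, h1, h2, h3]
  · linear_combination r * hw
  all_goals ring

theorem exists_idComponent1_mulVec_eq (X : V7) :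
    ∃ U ∈ idComponent Omega1, U *ᵥ ![0, 0, 0, 0, 0, 0, 1] = ![0, 0, 0, 0, 0, 0, 1] ∧
      ∃ r : ℝ, 0 ≤ r ∧ U *ᵥ X = ![r, 0, 0, 0, 0, 0, X 6] := by
  obtain ⟨r, hr, v, hv, h⟩ := exists_rot23_mulVec_eq X
  obtain ⟨s, hs, w, hw, h'⟩ := exists_rot12_mulVec_eq (rot23 v *ᵥ X)
  refine ⟨rot12 w * rot23 v,
    idComponent.mul_mem (rot12_mem_idComponent hw) (rot23_mem_idComponent hv), ?_, s, hs, ?_⟩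
  · rw [← mulVec_mulVec, rot23_mulVec, rot12_mulVec]
    simp
  · rw [← mulVec_mulVec, h', h]
    simp

set_option maxHeartbeats 1000000 in
theorem IsInfinitesimalSymmetry.skew1 {D : M7} (hD : IsInfinitesimalSymmetry Omega1 D) :
    Dᵀ * 1 + 1 * D = 0 := by
  have h := fun i j k => hD (Pi.single i 1) (Pi.single j 1) (Pi.single k 1)
  simp only [Omega1_eq, gram1_apply] at h
  simp only [mulVec_single_one] at h
  have h012 := h 0 1 2
  have h013 := h 0 1 3
  have h014 := h 0 1 4
  have h015 := h 0 1 5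
  have h016 := h 0 1 6
  have h023 := h 0 2 3
  have h024 := h 0 2 4
  have h025 := h 0 2 5
  have h026 := h 0 2 6
  have h034 := h 0 3 4
  have h035 := h 0 3 5
  have h036 := h 0 3 6
  have h045 := h 0 4 5
  have h046 := h 0 4 6
  have h056 := h 0 5 6
  have h123 := h 1 2 3
  have h124 := h 1 2 4
  have h125 := h 1 2 5
  have h126 := h 1 2 6
  have h134 := h 1 3 4
  have h135 := h 1 3 5
  have h136 := h 1 3 6
  have h145 := h 1 4 5
  have h146 := h 1 4 6
  have h156 := h 1 5 6
  have h234 := h 2 3 4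
  have h235 := h 2 3 5
  have h236 := h 2 3 6
  have h245 := h 2 4 5
  have h246 := h 2 4 6
  have h256 := h 2 5 6
  have h345 := h 3 4 5
  have h346 := h 3 4 6
  have h356 := h 3 5 6
  have h456 := h 4 5 6
  clear h hD
  simp [cross1] at *
  ext i j
  simp only [Matrix.add_apply, transpose_apply]
  fin_cases i <;> fin_cases j <;> simp <;> linarith

theorem eq_smul_gram1 {T : M7} (hT : Tᵀ = T)
    (h : ∀ D, IsInfinitesimalSymmetry Omega1 D → Dᵀ * T + T * D = 0) :
    ∃ c : ℝ, T = c • (1 : M7) := by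
  obtain ⟨D, hD⟩ : ∃ D : M7, D = !![0, 0, 0, -1, 0, 0, 0; 0, 0, 0, 0, -2, 0, 0;
      0, 0, 0, 0, 0, 3, 0; 1, 0, 0, 0, 0, 0, 0; 0, 2, 0, 0, 0, 0, 0; 0, 0, -3, 0, 0, 0, 0;
      0, 0, 0, 0, 0, 0, 0] := ⟨_, rfl⟩
  obtain ⟨d, hd⟩ : ∃ d : V7, d = ![1, 4, 9, 1, 4, 9, 0] := ⟨_, rfl⟩
  have h1 := h D fun X Y Z => by
    simp only [Omega1_eq, gram1_apply]
    simp only [mulVec_eq_vec7, Fin.sum_univ_seven]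
    simp [cross1, hD]
    ring
  have h2 := h !![0, 0, 0, 0, 0, 0, 1; 0, 0, 0, 0, 0, -1, 0; 0, 0, 0, 0, 0, 0, 0;
      0, 0, 0, 0, 0, 0, 0; 0, 0, 0, 0, 0, 0, 0; 0, 1, 0, 0, 0, 0, 0; -1, 0, 0, 0, 0, 0, 0] (by
    intro X Y Z
    simp only [Omega1_eq, gram1_apply]
    simp only [mulVec_eq_vec7, Fin.sum_univ_seven]
    simp [cross1]
    ring)
  have h3 := h !![0, -1, 0, 0, 0, 0, 0; 1, 0, 0, 0, 0, 0, 0; 0, 0, 0, 0, 0, 0, 0;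
      0, 0, 0, 0, -1, 0, 0; 0, 0, 0, 1, 0, 0, 0; 0, 0, 0, 0, 0, 0, 0; 0, 0, 0, 0, 0, 0, 0] (by
    intro X Y Z
    simp only [Omega1_eq, gram1_apply]
    simp only [mulVec_eq_vec7, Fin.sum_univ_seven]
    simp [cross1]
    ring)
  have hz : ∀ i j, d i - d j ≠ 0 → T i j = 0 := by
    have hDt : Dᵀ = -D := by
      ext i j
      fin_cases i <;> fin_cases j <;> simp [hD]
    have hDD : D * D = -diagonal d := by
      ext i j
      fin_cases i <;> fin_cases j <;>
        simp [hD, hd, Matrix.mul_apply, Fin.sum_univ_seven] <;> norm_num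
    have hc : D * T = T * D := by rwa [hDt, Matrix.neg_mul, neg_add_eq_zero] at h1
    have hcc : D * D * T = T * (D * D) := by
      rw [Matrix.mul_assoc, hc, ← Matrix.mul_assoc, hc, Matrix.mul_assoc]
    intro i j hij
    have := congrFun₂ hcc i j
    simp [hDD] at this
    exact (mul_eq_zero.1 (by linear_combination this : (d i - d j) * T i j = 0)).resolve_left hij
  have h00 := congrFun₂ h1 0 0
  have h03 := congrFun₂ h1 0 3
  have h11 := congrFun₂ h1 1 1
  have h14 := congrFun₂ h1 1 4
  have h22 := congrFun₂ h1 2 2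
  have h25 := congrFun₂ h1 2 5
  have h06 := congrFun₂ h2 0 6
  have h15 := congrFun₂ h2 1 5
  have h01 := congrFun₂ h3 0 1
  simp [Matrix.mul_apply, Fin.sum_univ_seven, hD] at h00 h03 h11 h14 h22 h25 h06 h15 h01
  have h30 : T 0 3 = T 3 0 := congrFun₂ hT 3 0
  have h41 : T 1 4 = T 4 1 := congrFun₂ hT 4 1
  have h52 : T 2 5 = T 5 2 := congrFun₂ hT 5 2
  refine ⟨T 0 0, ?_⟩
  ext i j
  fin_cases i <;> fin_cases j <;> simp <;>
    first
    | linarith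
    | exact hz _ _ (by simp [hd] <;> norm_num)

theorem GSet.preserves1 {A : M7} (hA : A ∈ GSet Omega1) :
    (∀ X Y, (A *ᵥ X) ⬝ᵥ (1 : M7) *ᵥ (A *ᵥ Y) = X ⬝ᵥ (1 : M7) *ᵥ Y) ∧
      ∀ X Y, cross1 (A *ᵥ X) (A *ᵥ Y) = A *ᵥ cross1 X Y :=
  GSet.preserves_form_and_cross isUnit_one transpose_one Omega1_eq cross1_gram1
    (fun _ => IsInfinitesimalSymmetry.skew1) (fun _ => eq_smul_gram1)
    (X₀ := ![1, 0, 0, 0, 0, 0, 0]) (Y₀ := ![0, 1, 0, 0, 0, 0, 0])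
    (by rw [gram1_apply]; simp [cross1]) hA

theorem GSet.eq_one_of_fixes1 {A : M7} (hA : A ∈ GSet Omega1)
    (h0 : A *ᵥ ![1, 0, 0, 0, 0, 0, 0] = ![1, 0, 0, 0, 0, 0, 0])
    (h1 : A *ᵥ ![0, 1, 0, 0, 0, 0, 0] = ![0, 1, 0, 0, 0, 0, 0])
    (h6 : A *ᵥ ![0, 0, 0, 0, 0, 0, 1] = ![0, 0, 0, 0, 0, 0, 1]) : A = 1 := by
  have hC := (GSet.preserves1 hA).2
  have h2 := hC ![1, 0, 0, 0, 0, 0, 0] ![0, 1, 0, 0, 0, 0, 0]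
  have h3 := hC ![0, 0, 0, 0, 0, 0, 1] ![1, 0, 0, 0, 0, 0, 0]
  have h4 := hC ![0, 0, 0, 0, 0, 0, 1] ![0, 1, 0, 0, 0, 0, 0]
  have h5 := hC ![0, 0, 0, 0, 0, 0, 1] (cross1 ![1, 0, 0, 0, 0, 0, 0] ![0, 1, 0, 0, 0, 0, 0])
  rw [h0, h1] at h2
  rw [h6, h0] at h3
  rw [h6, h1] at h4
  rw [h6, ← h2] at h5
  ext i j
  replace h0 := congrFun h0 i
  replace h1 := congrFun h1 i
  replace h2 := congrFun h2 i
  replace h3 := congrFun h3 i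
  replace h4 := congrFun h4 i
  replace h5 := congrFun h5 i
  replace h6 := congrFun h6 i
  clear hC
  simp only [mulVec, dotProduct, Fin.sum_univ_seven] at h0 h1 h2 h3 h4 h5 h6
  simp [cross1] at h0 h1 h2 h3 h4 h5 h6
  fin_cases j <;> simp [*] <;> fin_cases i <;> simp at * <;> linarith

theorem isConnected_GSet_Omega1 : IsConnected (GSet Omega1) := by
  have fix60 : ∀ A ∈ GSet Omega1, A *ᵥ ![0, 0, 0, 0, 0, 0, 1] = ![0, 0, 0, 0, 0, 0, 1] →
      A *ᵥ ![1, 0, 0, 0, 0, 0, 0] = ![1, 0, 0, 0, 0, 0, 0] →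
      ∃ V ∈ idComponent Omega1, V * A = 1 := by
    intro A hA h6 h0
    obtain ⟨hN, hC⟩ := GSet.preserves1 hA
    have h3 := hC ![0, 0, 0, 0, 0, 0, 1] ![1, 0, 0, 0, 0, 0, 0]
    rw [h6, h0] at h3
    obtain ⟨Y, hY⟩ : ∃ Y, Y = A *ᵥ ![0, 1, 0, 0, 0, 0, 0] := ⟨_, rfl⟩
    have n6 := hN ![0, 0, 0, 0, 0, 0, 1] ![0, 1, 0, 0, 0, 0, 0]
    have n0 := hN ![1, 0, 0, 0, 0, 0, 0] ![0, 1, 0, 0, 0, 0, 0]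
    have n3 := hN (cross1 ![0, 0, 0, 0, 0, 0, 1] ![1, 0, 0, 0, 0, 0, 0]) ![0, 1, 0, 0, 0, 0, 0]
    rw [h6, ← hY, gram1_apply, gram1_apply] at n6
    rw [h0, ← hY, gram1_apply, gram1_apply] at n0
    rw [← h3, ← hY, gram1_apply, gram1_apply] at n3
    simp [cross1] at n6 n0 n3
    obtain ⟨r, hr, w, hw, hU⟩ := exists_rot23_mulVec_eq Y
    have hUG := rot23_mem_idComponent hw
    have hr1 := (GSet.preserves1 (GSet.mul_mem hUG.1 hA)).1 ![0, 1, 0, 0, 0, 0, 0]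
      ![0, 1, 0, 0, 0, 0, 0]
    rw [← mulVec_mulVec, ← hY, hU, gram1_apply, gram1_apply] at hr1
    simp [n6, n0, n3] at hr1
    have hr1' : r = 1 := by nlinarith
    refine ⟨_, hUG, GSet.eq_one_of_fixes1 (GSet.mul_mem hUG.1 hA) ?_ ?_ ?_⟩
    · rw [← mulVec_mulVec, h0, rot23_mulVec]
      simp
    · rw [← mulVec_mulVec, ← hY, hU, n0, n3, n6, hr1']
    · rw [← mulVec_mulVec, h6, rot23_mulVec]
      simp
  have fix6 : ∀ A ∈ GSet Omega1, A *ᵥ ![0, 0, 0, 0, 0, 0, 1] = ![0, 0, 0, 0, 0, 0, 1] →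
      ∃ V ∈ idComponent Omega1, V * A = 1 := by
    intro A hA h6
    obtain ⟨U, hU, k6, r, hr, hUr⟩ :=
      exists_idComponent1_mulVec_eq (A *ᵥ ![1, 0, 0, 0, 0, 0, 0])
    have hUA := GSet.mul_mem hU.1 hA
    rw [mulVec_mulVec] at hUr
    have n6 := (GSet.preserves1 hA).1 ![0, 0, 0, 0, 0, 0, 1] ![1, 0, 0, 0, 0, 0, 0]
    have n0 := (GSet.preserves1 hUA).1 ![1, 0, 0, 0, 0, 0, 0] ![1, 0, 0, 0, 0, 0, 0]
    rw [h6, gram1_apply, gram1_apply] at n6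
    simp only [cons_val, zero_mul, one_mul, zero_add, add_zero, mul_zero] at n6
    rw [hUr, n6, gram1_apply, gram1_apply] at n0
    simp at n0
    have hr1 : r = 1 := by nlinarith
    exact idComponent.exists_mul_eq_one hU
      (fix60 _ hUA (by rw [← mulVec_mulVec, h6, k6]) (by rw [hUr, n6, hr1]))
  refine GSet.isConnected_of_reduction fun A hA => ?_
  obtain ⟨U, hU, -, r, hr, hUr⟩ := exists_idComponent1_mulVec_eq (A *ᵥ ![0, 0, 0, 0, 0, 0, 1])
  have hUA := GSet.mul_mem hU.1 hA
  rw [mulVec_mulVec] at hUr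
  generalize (A *ᵥ ![0, 0, 0, 0, 0, 0, 1]) 6 = s at hUr
  have hn := (GSet.preserves1 hUA).1 ![0, 0, 0, 0, 0, 0, 1] ![0, 0, 0, 0, 0, 0, 1]
  rw [hUr, gram1_apply, gram1_apply] at hn
  simp at hn
  have hR : rot06 ![s, -r] ∈ idComponent Omega1 :=
    rot06_mem_idComponent (by simp; linear_combination hn)
  refine idComponent.exists_mul_eq_one hU (idComponent.exists_mul_eq_one hR
    (fix6 _ (GSet.mul_mem hR.1 hUA) ?_))
  rw [← mulVec_mulVec, hUr, rot06_mulVec]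
  apply vec7_ext <;> simp
  · ring
  · linear_combination hn

/-- the stabilizer groups `G_{Ω₀}` and `G_{Ω₁}` of the two generic
3-forms on `ℝ⁷` are connected subsets of the space of `7×7` real matrices with its
standard topology. -/
theorem stmt15 : IsConnected (GSet Omega0) ∧ IsConnected (GSet Omega1) :=
  ⟨isConnected_GSet_Omega0, isConnected_GSet_Omega1⟩
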